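/- Let X ⊂ ℂⁿ be an unbounded complex algebraic set, i.e., X is unbounded and is the common zero set of a set of polynomials in ℂ[x₁,…,xₙ]. Let I(X) := {f ∈ ℂ[x₁,…,xₙ] : f(x) = 0 for all x ∈ X} be its vanishing ideal. Then C_∞(X) = {v ∈ ℂⁿ : f*(v) = 0 for every nonzero f ∈ I(X)}, where for a nonzero polynomial f, f* denotes the homogeneous component of f of degree equal to the total degree of f. -/

import Mathlib

open MvPolynomial

/-- The tangent cone at infinity of a subset `A ⊆ ℂⁿ`. -/
def tangentConeAtInfinity {n : ℕ} (A : Set (EuclideanSpace ℂ (Fin n))) :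
    Set (EuclideanSpace ℂ (Fin n)) :=
  {v | ∃ (x : ℕ → EuclideanSpace ℂ (Fin n)) (t : ℕ → ℝ),
    (∀ i, x i ∈ A) ∧ (∀ i, 0 < t i) ∧
    Filter.Tendsto (fun i => ‖x i‖) Filter.atTop Filter.atTop ∧
    Filter.Tendsto (fun i => (t i)⁻¹ • x i) Filter.atTop (nhds v)}

open Filter Topology

variable {σ : Type*} {n : ℕ}

/-- A substitution of polynomials of degree at most one turns the degree `d` component of `f`
into the coefficient of degree `d`. -/
theorem natDegree_le_and_coeff_of_linear {R : Type*} [CommRing R] [Algebra ℂ R]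
    (g : MvPolynomial σ ℂ →ₐ[ℂ] Polynomial R) (c : σ → R)
    (hg : ∀ i, (g (X i)).natDegree ≤ 1 ∧ (g (X i)).coeff 1 = c i)
    (f : MvPolynomial σ ℂ) {d : ℕ} (hf : f.totalDegree ≤ d) :
    (g f).natDegree ≤ d ∧ (g f).coeff d = aeval c (homogeneousComponent d f) := by
  have hone (s : σ →₀ ℕ) : (g (monomial s 1)).natDegree ≤ s.degree ∧
      (g (monomial s 1)).coeff s.degree = aeval c (monomial s (1 : ℂ)) := by
    induction s using Finsupp.induction_linear with
    | zero => simp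
    | add s t hs ht =>
      have : (monomial (s + t) 1 : MvPolynomial σ ℂ) = monomial s 1 * monomial t 1 := by
        simp [monomial_mul]
      rw [this, map_mul, map_mul, map_add, ← hs.2, ← ht.2]
      exact ⟨Polynomial.natDegree_mul_le_of_le hs.1 ht.1,
        Polynomial.coeff_mul_add_eq_of_natDegree_le hs.1 ht.1⟩
    | single i k =>
      have : (monomial (Finsupp.single i k) 1 : MvPolynomial σ ℂ) = X i ^ k :=
        (X_pow_eq_monomial ..).symm
      rw [this, map_pow, map_pow, aeval_X, ← (hg i).2, Finsupp.degree_single]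
      have h := Polynomial.coeff_pow_of_natDegree_le (m := k) (hg i).1
      have h' := Polynomial.natDegree_pow_le_of_le k (hg i).1
      rw [mul_one] at h h'
      exact ⟨h', h⟩
  have hmon (s : σ →₀ ℕ) (a : ℂ) : g (monomial s a) = a • g (monomial s 1) := by
    rw [← map_smul, smul_monomial, smul_eq_mul, mul_one]
  have hdeg (s : σ →₀ ℕ) (hs : s ∈ f.support) : s.degree ≤ d :=
    (le_totalDegree hs).trans hf
  constructor
  · conv_lhs => rw [f.as_sum, map_sum]
    refine Polynomial.natDegree_sum_le_of_forall_le _ _ fun s hs => ?_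
    rw [hmon]
    exact (Polynomial.natDegree_smul_le _ _).trans ((hone s).1.trans (hdeg s hs))
  · conv_lhs => rw [f.as_sum, map_sum, Polynomial.finsetSum_coeff]
    rw [homogeneousComponent_apply, map_sum, Finset.sum_filter]
    refine Finset.sum_congr rfl fun s hs => ?_
    rw [hmon, Polynomial.coeff_smul]
    split_ifs with h
    · rw [← h, (hone s).2, ← map_smul, smul_monomial, smul_eq_mul, mul_one]
    · rw [Polynomial.coeff_eq_zero_of_natDegree_lt, smul_zero]
      exact (hone s).1.trans_lt (lt_of_le_of_ne (hdeg s hs) h)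

theorem eval_homogeneousComponent_mul (v : σ → ℂ) {f g : MvPolynomial σ ℂ} {d e : ℕ}
    (hf : f.totalDegree ≤ d) (hg : g.totalDegree ≤ e) :
    eval v (homogeneousComponent (d + e) (f * g)) =
      eval v (homogeneousComponent d f) * eval v (homogeneousComponent e g) := by
  let φ : MvPolynomial σ ℂ →ₐ[ℂ] Polynomial ℂ :=
    aeval fun i => Polynomial.C (v i) * Polynomial.X
  have h (p : MvPolynomial σ ℂ) {k : ℕ} (hp : p.totalDegree ≤ k) :=
    natDegree_le_and_coeff_of_linear φ v
      (fun i => by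
        simpa [φ] using (Polynomial.natDegree_C_mul_le (v i) Polynomial.X).trans
          Polynomial.natDegree_X_le) p hp
  simp only [← coe_aeval_eq_eval, RingHom.coe_coe]
  rw [← (h _ ((totalDegree_mul f g).trans (add_le_add hf hg))).2, ← (h f hf).2, ← (h g hg).2,
    map_mul]
  exact Polynomial.coeff_mul_add_eq_of_natDegree_le (h f hf).1 (h g hg).1

theorem eval_smul_of_isHomogeneous {f : MvPolynomial σ ℂ} {d : ℕ} (hf : f.IsHomogeneous d)
    (a : ℂ) (x : σ → ℂ) : eval (a • x) f = a ^ d * eval x f := by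
  rw [eval_eq, eval_eq, Finset.mul_sum]
  refine Finset.sum_congr rfl fun s hs => ?_
  have hs : s.degree = d := by
    by_contra h
    exact mem_support_iff.1 hs (hf.coeff_eq_zero h)
  simp only [Pi.smul_apply, smul_eq_mul, mul_pow, Finset.prod_mul_distrib,
    Finset.prod_pow_eq_pow_sum]
  rw [← hs, Finsupp.degree_apply]
  ring

/-- The common zeros of the top-degree forms of the elements of an ideal. -/
def initialCone (I : Ideal (MvPolynomial σ ℂ)) : Set (σ → ℂ) :=
  {v | ∀ f ∈ I, ∀ d, f.totalDegree ≤ d → eval v (homogeneousComponent d f) = 0}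

/-- The limits of rescaled points of the zero locus of an ideal, with scales tending to infinity. -/
def limitDirections (I : Ideal (MvPolynomial σ ℂ)) : Set (σ → ℂ) :=
  {v | ∃ (x : ℕ → σ → ℂ) (t : ℕ → ℝ), (∀ i, ∀ f ∈ I, eval (x i) f = 0) ∧ (∀ i, 0 < t i) ∧
    Tendsto t atTop atTop ∧ Tendsto (fun i => ((t i : ℂ))⁻¹ • x i) atTop (𝓝 v)}

theorem tendsto_eval_div_pow {f : MvPolynomial σ ℂ} {d : ℕ} (hf : f.totalDegree ≤ d)
    {x : ℕ → σ → ℂ} {a : ℕ → ℂ} (ha : Tendsto (fun i => ‖a i‖) atTop atTop) {v : σ → ℂ}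
    (hx : Tendsto (fun i => (a i)⁻¹ • x i) atTop (𝓝 v)) :
    Tendsto (fun i => eval (x i) f / a i ^ d) atTop
      (𝓝 (eval v (homogeneousComponent d f))) := by
  have hinv : Tendsto (fun i => (a i)⁻¹) atTop (𝓝 0) :=
    tendsto_inv₀_cobounded.comp (tendsto_norm_atTop_iff_cobounded.1 ha)
  have hsum : f = ∑ k ∈ Finset.range (d + 1), homogeneousComponent k f := by
    conv_lhs => rw [← sum_homogeneousComponent f]
    refine Finset.sum_subset (Finset.range_mono (by omega)) fun k _ hk => ?_
    exact homogeneousComponent_eq_zero _ _ (by simpa using hk)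
  have hterm (k : ℕ) : Tendsto (fun i => (a i)⁻¹ ^ (d - k) *
      eval ((a i)⁻¹ • x i) (homogeneousComponent k f)) atTop
      (𝓝 (0 ^ (d - k) * eval v (homogeneousComponent k f))) :=
    (hinv.pow _).mul (((continuous_eval _).tendsto v).comp hx)
  have := tendsto_finsetSum (Finset.range (d + 1)) fun k _ => hterm k
  rw [Finset.sum_range_succ, Finset.sum_eq_zero, zero_add, Nat.sub_self, pow_zero, one_mul] at this
  · refine this.congr' ?_
    filter_upwards [ha.eventually_gt_atTop 0] with i hi
    have hi : a i ≠ 0 := norm_pos_iff.1 hi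
    conv_rhs => rw [hsum, map_sum, Finset.sum_div]
    refine Finset.sum_congr rfl fun k hk => ?_
    have hk : k ≤ d := by simpa [Nat.lt_succ_iff] using hk
    rw [eval_smul_of_isHomogeneous (homogeneousComponent_isHomogeneous k f), inv_pow, inv_pow,
      ← mul_assoc, ← mul_inv, ← pow_add, Nat.sub_add_cancel hk, div_eq_inv_mul]
  · intro k hk
    rw [zero_pow (by have := Finset.mem_range.1 hk; omega), zero_mul]

theorem mem_initialCone_of_tendsto {I : Ideal (MvPolynomial σ ℂ)}
    {x : ℕ → σ → ℂ} (hxI : ∀ i, ∀ f ∈ I, eval (x i) f = 0)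
    {a : ℕ → ℂ} (ha : Tendsto (fun i => ‖a i‖) atTop atTop) {v : σ → ℂ}
    (hx : Tendsto (fun i => (a i)⁻¹ • x i) atTop (𝓝 v)) : v ∈ initialCone I := by
  intro f hf d hd
  refine tendsto_nhds_unique (tendsto_eval_div_pow hd ha hx) ?_
  simp [hxI _ f hf]

/-- Precomposition of polynomials with a linear map. -/
noncomputable def linearPullback {m : ℕ} (A : (Fin n → ℂ) →ₗ[ℂ] (Fin m → ℂ)) :
    MvPolynomial (Fin m) ℂ →ₐ[ℂ] MvPolynomial (Fin n) ℂ :=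
  aeval fun i => ∑ j, C (A (Pi.single j 1) i) * X j

theorem eval_linearPullback {m : ℕ} (A : (Fin n → ℂ) →ₗ[ℂ] (Fin m → ℂ))
    (x : Fin n → ℂ) (f : MvPolynomial (Fin m) ℂ) :
    eval x (linearPullback A f) = eval (A x) f := by
  have hA : (fun i => ∑ j, A (Pi.single j 1) i * x j) = A x := by
    conv_rhs => rw [← LinearMap.sum_single_apply (fun _ => ℂ) x, map_sum]
    ext i
    rw [Finset.sum_apply]
    refine Finset.sum_congr rfl fun j _ => ?_
    rw [show (Pi.single j (x j) : Fin n → ℂ) = x j • Pi.single j 1 by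
      rw [← Pi.single_smul, smul_eq_mul, mul_one], map_smul, Pi.smul_apply, smul_eq_mul, mul_comm]
  rw [← hA]
  simp only [linearPullback, ← coe_aeval_eq_eval, RingHom.coe_coe]
  rw [← AlgHom.comp_apply, comp_aeval]
  simp

theorem isHomogeneous_linearPullback {m : ℕ} (A : (Fin n → ℂ) →ₗ[ℂ] (Fin m → ℂ))
    (f : MvPolynomial (Fin m) ℂ) (k : ℕ) :
    (linearPullback A (homogeneousComponent k f)).IsHomogeneous k := by
  have := (homogeneousComponent_isHomogeneous k f).aeval
    (fun i => ∑ j, C (A (Pi.single j 1) i) * X j) (n := 1) fun i =>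
      IsHomogeneous.sum _ _ 1 fun j _ => isHomogeneous_C_mul_X (A (Pi.single j 1) i) j
  rwa [one_mul] at this

theorem homogeneousComponent_linearPullback {m : ℕ} (A : (Fin n → ℂ) →ₗ[ℂ] (Fin m → ℂ))
    (f : MvPolynomial (Fin m) ℂ) (d : ℕ) :
    homogeneousComponent d (linearPullback A f) = linearPullback A (homogeneousComponent d f) := by
  have hom := isHomogeneous_linearPullback A f
  conv_lhs => rw [← sum_homogeneousComponent f]
  rw [map_sum, map_sum]
  by_cases hd : d ∈ Finset.range (f.totalDegree + 1)
  · rw [Finset.sum_eq_single_of_mem d hd, homogeneousComponent_of_mem (hom d), if_pos rfl]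
    intro k _ hk
    rw [homogeneousComponent_of_mem (hom k), if_neg hk.symm]
  · rw [Finset.sum_eq_zero, homogeneousComponent_eq_zero _ _ (by simpa using hd), map_zero]
    intro k hk
    rw [homogeneousComponent_of_mem (hom k), if_neg]
    rintro rfl
    exact hd hk

theorem totalDegree_linearPullback_le {m : ℕ} (A : (Fin n → ℂ) →ₗ[ℂ] (Fin m → ℂ))
    (f : MvPolynomial (Fin m) ℂ) : (linearPullback A f).totalDegree ≤ f.totalDegree := by
  conv_lhs => rw [← sum_homogeneousComponent f, map_sum]
  refine totalDegree_finsetSum_le fun k hk => ?_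
  exact (isHomogeneous_linearPullback A f k).totalDegree_le.trans
    (Nat.lt_succ_iff.1 (Finset.mem_range.1 hk))

theorem map_mem_initialCone {m : ℕ} (A : (Fin n → ℂ) →ₗ[ℂ] (Fin m → ℂ))
    {I : Ideal (MvPolynomial (Fin n) ℂ)} {v : Fin n → ℂ} (hv : v ∈ initialCone I) :
    A v ∈ initialCone (I.comap (linearPullback A)) := by
  intro f hf d hd
  rw [← eval_linearPullback, ← homogeneousComponent_linearPullback]
  exact hv _ hf d ((totalDegree_linearPullback_le A f).trans hd)

theorem limitDirections_anti {I J : Ideal (MvPolynomial σ ℂ)} (h : I ≤ J) :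
    limitDirections J ⊆ limitDirections I := by
  rintro v ⟨x, t, hx, ht⟩
  exact ⟨x, t, fun i f hf => hx i f (h hf), ht⟩

theorem mem_initialCone_or_of_mul_le {I J K : Ideal (MvPolynomial σ ℂ)} (h : J * K ≤ I)
    {v : σ → ℂ} (hv : v ∈ initialCone I) : v ∈ initialCone J ∨ v ∈ initialCone K := by
  by_contra! hc
  simp only [initialCone, Set.mem_ofPred_eq, not_forall] at hc
  obtain ⟨⟨f, hf, d, hd, hfv⟩, g, hg, e, he, hgv⟩ := hc
  have := hv _ (h (Ideal.mul_mem_mul hf hg)) (d + e)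
    ((totalDegree_mul f g).trans (add_le_add hd he))
  rw [eval_homogeneousComponent_mul v hd he] at this
  exact mul_ne_zero hfv hgv this

theorem mem_limitDirections_of_forall_isPrime [Finite σ] {v : σ → ℂ}
    (h : ∀ P : Ideal (MvPolynomial σ ℂ), P.IsPrime → v ∈ initialCone P → v ∈ limitDirections P)
    (I : Ideal (MvPolynomial σ ℂ)) (hv : v ∈ initialCone I) : v ∈ limitDirections I := by
  induction I using IsNoetherian.induction with
  | _ I ih =>
  by_cases hP : Ideal.IsPrime I
  · exact h I hP hv
  rw [Ideal.isPrime_iff] at hP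
  push Not at hP
  by_cases htop : I = ⊤
  · have := hv 1 (htop ▸ Submodule.mem_top) 0 (by simp)
    simp [homogeneousComponent_zero] at this
  obtain ⟨a, b, hab, ha, hb⟩ := hP htop
  have hlt (c : MvPolynomial σ ℂ) (hc : c ∉ I) : I < I ⊔ Ideal.span {c} :=
    lt_of_le_of_ne le_sup_left fun he => hc <| he ▸
      (le_sup_right : _ ≤ I ⊔ Ideal.span {c}) (Ideal.mem_span_singleton_self c)
  have hmul : (I ⊔ Ideal.span {a}) * (I ⊔ Ideal.span {b}) ≤ I := by
    rw [Ideal.sup_mul, Ideal.mul_sup, Ideal.mul_sup, Ideal.span_singleton_mul_span_singleton]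
    refine sup_le (sup_le Ideal.mul_le_right Ideal.mul_le_left)
      (sup_le Ideal.mul_le_right ?_)
    rwa [Ideal.span_singleton_le_iff_mem]
  rcases mem_initialCone_or_of_mul_le hmul hv with h' | h'
  · exact limitDirections_anti le_sup_left (ih _ (hlt a ha) h')
  · exact limitDirections_anti le_sup_left (ih _ (hlt b hb) h')

theorem exists_root_norm_pow_le {p : Polynomial ℂ} {d : ℕ} (hd : d ≠ 0) (hp : p.natDegree = d) :
    ∃ s, p.eval s = 0 ∧ ‖s‖ ^ d ≤ ‖p.coeff 0 / p.coeff d‖ := by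
  have hp0 : p ≠ 0 := by rintro rfl; simp at hp; omega
  have hs : p.Splits := IsAlgClosed.splits p
  have hcard : p.roots.card = d := by rw [← hs.natDegree_eq_card_roots, hp]
  have hlc : p.coeff d ≠ 0 := by
    rw [← hp]; exact Polynomial.leadingCoeff_ne_zero.2 hp0
  have hprod : ‖p.coeff 0 / p.coeff d‖ = (p.roots.map (‖·‖)).prod := by
    rw [hs.coeff_zero_eq_leadingCoeff_mul_prod_roots, Polynomial.leadingCoeff, hp,
      mul_right_comm, mul_div_cancel_right₀ _ hlc, norm_mul, norm_pow, norm_neg, norm_one, one_pow,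
      one_mul]
    exact map_multiset_prod (normHom : ℂ →*₀ ℝ) p.roots
  obtain ⟨s, hsr, hmin⟩ : ∃ s ∈ p.roots, ∀ r ∈ p.roots, ‖s‖ ≤ ‖r‖ := by
    have hne : p.roots.toFinset.Nonempty := by
      rw [Multiset.toFinset_nonempty, ← Multiset.card_pos, hcard]; omega
    obtain ⟨s, hs, h⟩ := p.roots.toFinset.exists_min_image (‖·‖) hne
    exact ⟨s, by simpa using hs, fun r hr => h r (Multiset.mem_toFinset.2 hr)⟩
  refine ⟨s, (Polynomial.mem_roots hp0).1 hsr, ?_⟩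
  rw [hprod, ← hcard, ← Multiset.prod_replicate, ← Multiset.map_const']
  exact Multiset.prod_map_le_prod_map₀ _ _ (fun _ _ => norm_nonneg _) hmin

theorem homogeneousComponent_totalDegree_ne_zero {f : MvPolynomial σ ℂ} (hf : f ≠ 0) :
    homogeneousComponent f.totalDegree f ≠ 0 := by
  obtain ⟨s, hs, hd⟩ := f.support.exists_mem_eq_sup (support_nonempty.2 hf)
    fun s => s.sum fun _ e => e
  intro h
  have := coeff_homogeneousComponent f.totalDegree f s
  rw [h, coeff_zero, if_pos] at this
  · exact mem_support_iff.1 hs this.symm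
  · exact hd.symm

theorem exists_eval_homogeneousComponent_ne_zero [Finite σ] {f : MvPolynomial σ ℂ} (hf : f ≠ 0) :
    ∃ w, eval w (homogeneousComponent f.totalDegree f) ≠ 0 := by
  by_contra! h
  exact homogeneousComponent_totalDegree_ne_zero hf (MvPolynomial.funext fun x => by simp [h x])

theorem mem_limitDirections_span_singleton [Finite σ] {F : MvPolynomial σ ℂ} {v : σ → ℂ}
    (hv : v ∈ initialCone (Ideal.span {F})) : v ∈ limitDirections (Ideal.span {F}) := by
  by_cases hF : F = 0
  · refine ⟨fun i => ((i : ℂ) + 1) • v, fun i => i + 1, ?_, fun i => by positivity,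
      tendsto_atTop_add_const_right _ _ tendsto_natCast_atTop_atTop, ?_⟩
    · intro i f hf
      rw [hF, Ideal.span_singleton_eq_bot.2 rfl, Ideal.mem_bot] at hf
      simp [hf]
    · refine tendsto_const_nhds.congr fun i => ?_
      rw [smul_smul]
      push_cast
      rw [inv_mul_cancel₀ (Nat.cast_add_one_ne_zero i), one_smul]
  obtain ⟨w, hw⟩ := exists_eval_homogeneousComponent_ne_zero hF
  set d := F.totalDegree
  have hv0 : eval v (homogeneousComponent d F) = 0 :=
    hv F (Ideal.mem_span_singleton_self F) d le_rfl
  have hd : d ≠ 0 := by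
    intro hd
    rw [hd, homogeneousComponent_zero, eval_C] at hw hv0
    exact hw hv0
  have key (t : ℂ) : ∃ s : ℂ, eval (t • v + s • w) F = 0 ∧
      ‖s‖ ^ d ≤ ‖eval (t • v) F / eval w (homogeneousComponent d F)‖ := by
    let φ : MvPolynomial σ ℂ →ₐ[ℂ] Polynomial ℂ :=
      aeval fun i => Polynomial.C (w i) * Polynomial.X + Polynomial.C (t * v i)
    have hφ (s : ℂ) : (φ F).eval s = eval (t • v + s • w) F := by
      rw [← Polynomial.coe_aeval_eq_eval, ← coe_aeval_eq_eval, RingHom.coe_coe,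
        ← AlgHom.comp_apply, comp_aeval]
      congr 2
      ext i
      simp
      ring
    obtain ⟨h1, h2⟩ := natDegree_le_and_coeff_of_linear φ w (fun i => by
      simp only [φ, aeval_X]
      exact ⟨Polynomial.natDegree_linear_le, by simp [Polynomial.coeff_C]⟩) F le_rfl
    have h2 : (φ F).coeff d = eval w (homogeneousComponent d F) := by
      rw [h2, ← coe_aeval_eq_eval, RingHom.coe_coe]
    obtain ⟨s, hs, hle⟩ := exists_root_norm_pow_le hd
      (h1.antisymm (Polynomial.le_natDegree_of_ne_zero (h2 ▸ hw)))
    refine ⟨s, by rw [← hφ, hs], ?_⟩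
    rwa [h2, Polynomial.coeff_zero_eq_eval_zero, hφ, zero_smul, add_zero] at hle
  choose s hs hle using key
  let t (i : ℕ) : ℝ := i + 1
  have ht : Tendsto t atTop atTop :=
    tendsto_atTop_add_const_right _ _ tendsto_natCast_atTop_atTop
  have htpos (i : ℕ) : 0 < t i := by positivity
  have ht0 (i : ℕ) : (t i : ℂ) ≠ 0 := Complex.ofReal_ne_zero.2 (htpos i).ne'
  have hlim : Tendsto (fun i => eval ((t i : ℂ) • v) F / (t i : ℂ) ^ d) atTop (𝓝 0) := by
    rw [← hv0]
    refine tendsto_eval_div_pow le_rfl ?_ ?_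
    · simpa [Function.comp_def] using tendsto_abs_atTop_atTop.comp ht
    · refine tendsto_const_nhds.congr fun i => ?_
      rw [smul_smul, inv_mul_cancel₀ (ht0 i), one_smul]
  have hs0 : Tendsto (fun i => (t i : ℂ)⁻¹ * s (t i)) atTop (𝓝 0) := by
    have hpow : Tendsto (fun i => ((t i : ℂ)⁻¹ * s (t i)) ^ d) atTop (𝓝 0) := by
      have := (hlim.div_const (eval w (homogeneousComponent d F))).norm
      rw [zero_div, norm_zero] at this
      refine squeeze_zero_norm (fun i => ?_) this
      rw [norm_pow, norm_mul, mul_pow, norm_inv, inv_pow, ← norm_pow, div_right_comm,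
        norm_div _ (_ ^ d), div_eq_inv_mul]
      gcongr
      exact hle _
    rw [tendsto_zero_iff_norm_tendsto_zero] at hpow ⊢
    have := hpow.rpow_const (p := (d : ℝ)⁻¹) (Or.inr (by positivity))
    rw [Real.zero_rpow (by positivity)] at this
    refine this.congr fun i => ?_
    rw [norm_pow, Real.pow_rpow_inv_natCast (norm_nonneg _) hd]
  refine ⟨fun i => (t i : ℂ) • v + s (t i) • w, t, fun i f hf => ?_, htpos, ht, ?_⟩
  · obtain ⟨g, rfl⟩ := Ideal.mem_span_singleton.1 hf
    rw [map_mul, hs, zero_mul]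
  · have := (hs0.smul_const w).const_add v
    rw [zero_smul, add_zero] at this
    refine this.congr fun i => ?_
    rw [smul_add, smul_smul, smul_smul, inv_mul_cancel₀ (ht0 i), one_smul]

/-- Forgetting the first coordinate. -/
def tailProj (n : ℕ) : (Fin (n + 1) → ℂ) →ₗ[ℂ] (Fin n → ℂ) := LinearMap.funLeft ℂ ℂ Fin.succ

theorem finSuccEquiv_linearPullback_tailProj (h : MvPolynomial (Fin n) ℂ) :
    finSuccEquiv ℂ n (linearPullback (tailProj n) h) = Polynomial.C h := by
  have hr : linearPullback (tailProj n) h = rename Fin.succ h :=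
    MvPolynomial.funext fun x => by rw [eval_linearPullback, eval_rename]; rfl
  rw [hr]
  clear hr
  induction h using MvPolynomial.induction_on with
  | C a => simp [finSuccEquiv_apply]
  | add p q hp hq => rw [map_add, map_add, map_add, hp, hq]
  | mul_X p i hp => rw [map_mul, map_mul, map_mul, hp, rename_X, finSuccEquiv_X_succ]

/-- A prime ideal without nonzero elements free of the first variable is principal. -/
theorem exists_eq_span_singleton_of_comap_eq_bot {I : Ideal (MvPolynomial (Fin (n + 1)) ℂ)}
    [hI : I.IsPrime] (h : I.comap (linearPullback (tailProj n)) = ⊥) :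
    ∃ F, I = Ideal.span {F} := by
  by_cases hbot : I = ⊥
  · exact ⟨0, by simpa using hbot⟩
  let e := finSuccEquiv ℂ n
  let deg (G : MvPolynomial (Fin (n + 1)) ℂ) : ℕ := (e G).natDegree
  obtain ⟨F, ⟨hFI, hF⟩, hmin⟩ : ∃ F, (F ∈ I ∧ Prime F) ∧ ∀ G ∈ I, G ≠ 0 → deg F ≤ deg G := by
    have hne : {G | G ∈ I ∧ G ≠ 0}.Nonempty := by
      obtain ⟨G, hG, hG0⟩ := Submodule.exists_mem_ne_zero_of_ne_bot hbot
      exact ⟨G, hG, hG0⟩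
    let G := Function.argminOn deg _ hne
    have hG : G ∈ I ∧ G ≠ 0 := Function.argminOn_mem deg _ hne
    obtain ⟨m, hm, u, hmu⟩ := UniqueFactorizationMonoid.exists_prime_factors G hG.2
    have hmI : m.prod ∈ I := by
      rw [← Units.eq_mul_inv_iff_mul_eq] at hmu
      rw [hmu]
      exact I.mul_mem_right _ hG.1
    obtain ⟨F, hFm, hFI⟩ := (hI.multiset_prod_mem_iff_exists_mem m).1 hmI
    refine ⟨F, ⟨hFI, hm F hFm⟩, fun H hH hH0 => le_trans ?_
      (Function.argminOn_le deg {G | G ∈ I ∧ G ≠ 0} ⟨hH, hH0⟩)⟩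
    refine Polynomial.natDegree_le_of_dvd (map_dvd e ?_) (by simpa using hG.2)
    exact (Multiset.dvd_prod hFm).trans ⟨u, hmu.symm⟩
  have hC (a : MvPolynomial (Fin n) ℂ) :
      e.symm (Polynomial.C a) = linearPullback (tailProj n) a := by
    rw [← finSuccEquiv_linearPullback_tailProj, AlgEquiv.symm_apply_apply]
  have hF0 : e F ≠ 0 := by simpa using hF.ne_zero
  refine ⟨F, le_antisymm (fun G hG => ?_) (by rwa [Ideal.span_singleton_le_iff_mem])⟩
  rw [Ideal.mem_span_singleton]
  induction hk : (e G).degree using WellFoundedLT.induction generalizing G with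
  | _ k ih =>
  by_cases hG0 : G = 0
  · simp [hG0]
  have hG0' : e G ≠ 0 := by simpa using hG0
  let a := (e F).leadingCoeff
  let b := (e G).leadingCoeff
  let q : Polynomial (MvPolynomial (Fin n) ℂ) :=
    Polynomial.C b * Polynomial.X ^ ((e G).natDegree - (e F).natDegree)
  have ha : a ≠ 0 := Polynomial.leadingCoeff_ne_zero.2 hF0
  have hb : b ≠ 0 := Polynomial.leadingCoeff_ne_zero.2 hG0'
  have hle : (e F).natDegree ≤ (e G).natDegree := hmin G hG hG0
  have hlt : (Polynomial.C a * e G - q * e F).degree < (e G).degree := by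
    have hdeg : (Polynomial.C a * e G).degree = (e G).degree := by
      rw [Polynomial.degree_mul, Polynomial.degree_C ha, zero_add]
    rw [← hdeg]
    refine Polynomial.degree_sub_lt_left ?_ (mul_ne_zero (by simpa using ha) hG0') ?_
    · rw [hdeg, Polynomial.degree_mul, Polynomial.degree_C_mul_X_pow _ hb,
        Polynomial.degree_eq_natDegree hG0', Polynomial.degree_eq_natDegree hF0, ← Nat.cast_add,
        Nat.sub_add_cancel hle]
    · simp only [q, Polynomial.leadingCoeff_mul, Polynomial.leadingCoeff_C,
        Polynomial.leadingCoeff_X_pow, mul_one]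
      exact mul_comm _ _
  have hdvd : F ∣ e.symm (Polynomial.C a) * G - e.symm q * F := by
    refine ih _ (hk ▸ hlt) _ (I.sub_mem (I.mul_mem_left _ hG) (I.mul_mem_left _ hFI)) ?_
    simp
  have hdvd' := (dvd_sub_left (Dvd.intro_left (e.symm q) rfl)).1 hdvd
  refine (hF.dvd_or_dvd hdvd').resolve_left fun hFa => ha ?_
  have : a ∈ I.comap (linearPullback (tailProj n)) := by
    rw [Ideal.mem_comap, ← hC]
    exact I.mem_of_dvd hFa hFI
  rwa [h, Ideal.mem_bot] at this

theorem mem_limitDirections_of_equiv (A : (Fin n → ℂ) ≃L[ℂ] (Fin n → ℂ))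
    {I : Ideal (MvPolynomial (Fin n) ℂ)} {v : Fin n → ℂ}
    (h : A v ∈ limitDirections (I.comap (linearPullback (A : (Fin n → ℂ) →ₗ[ℂ] (Fin n → ℂ))))) :
    v ∈ limitDirections I := by
  obtain ⟨y, t, hy, htpos, ht, hlim⟩ := h
  refine ⟨fun i => A.symm (y i), t, fun i f hf => ?_, htpos, ht, ?_⟩
  · rw [← hy i (linearPullback (A.symm : (Fin n → ℂ) →ₗ[ℂ] (Fin n → ℂ)) f)]
    · rw [eval_linearPullback]; rfl
    · rw [Ideal.mem_comap]
      convert hf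
      refine MvPolynomial.funext fun x => ?_
      rw [eval_linearPullback, eval_linearPullback]
      congr 2
      exact A.symm_apply_apply x
  · have := (A.symm.continuous.tendsto _).comp hlim
    rw [A.symm_apply_apply] at this
    refine this.congr fun i => ?_
    simp

/-- The linear projection along the direction `(1, u)`. -/
def shearProj (u : Fin n → ℂ) : (Fin (n + 1) → ℂ) →ₗ[ℂ] (Fin n → ℂ) :=
  tailProj n - (LinearMap.proj 0).smulRight u

theorem shearProj_apply (u : Fin n → ℂ) (x : Fin (n + 1) → ℂ) :
    shearProj u x = Fin.tail x - x 0 • u := rfl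

theorem linearPullback_shearProj_X (u : Fin n → ℂ) (j : Fin n) :
    linearPullback (shearProj u) (X j) = X j.succ - C (u j) * X 0 :=
  MvPolynomial.funext fun x => by
    rw [eval_linearPullback]
    simp [shearProj_apply, Fin.tail, mul_comm]

theorem isIntegral_comp_linearPullback_shearProj (u : Fin n → ℂ)
    {I : Ideal (MvPolynomial (Fin (n + 1)) ℂ)} {f : MvPolynomial (Fin (n + 1)) ℂ} (hfI : f ∈ I)
    {d : ℕ} (hd : f.totalDegree ≤ d) (hf : eval (Fin.cons 1 u) (homogeneousComponent d f) ≠ 0) :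
    ((Ideal.Quotient.mk I).comp (linearPullback (shearProj u)).toRingHom).IsIntegral := by
  set ψ := (Ideal.Quotient.mk I).comp (linearPullback (shearProj u)).toRingHom with hψ
  have hψC (a : ℂ) : ψ (C a) = Ideal.Quotient.mk I (C a) := by
    simp [hψ, ← algebraMap_eq]
  have h0 : ψ.IsIntegralElem (Ideal.Quotient.mk I (X 0)) := by
    let φ : MvPolynomial (Fin (n + 1)) ℂ →ₐ[ℂ] Polynomial (MvPolynomial (Fin n) ℂ) :=
      aeval (Fin.cons Polynomial.X fun j =>
        Polynomial.C (C (u j)) * Polynomial.X + Polynomial.C (X j))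
    obtain ⟨h1, h2⟩ := natDegree_le_and_coeff_of_linear φ
      (fun i => C ((Fin.cons 1 u : Fin (n + 1) → ℂ) i)) (fun i => by
        refine Fin.cases ?_ (fun j => ?_) i
        · simp [φ]
        · simp only [φ, aeval_X, Fin.cons_succ]
          exact ⟨Polynomial.natDegree_linear_le, by simp [Polynomial.coeff_C]⟩) f hd
    set c := eval (Fin.cons 1 u) (homogeneousComponent d f)
    have h2 : (φ f).coeff d = C c := by
      rw [h2]
      exact aeval_algebraMap_apply (MvPolynomial (Fin n) ℂ) _ _
    have h3 : (φ f).eval₂ ψ (Ideal.Quotient.mk I (X 0)) = 0 := by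
      have : ((Polynomial.eval₂RingHom ψ (Ideal.Quotient.mk I (X 0))).comp φ.toRingHom) =
          Ideal.Quotient.mk I := by
        refine MvPolynomial.ringHom_ext (fun a => ?_) fun i => ?_
        · simp [φ, hψC, ← algebraMap_eq]
        · refine Fin.cases ?_ (fun j => ?_) i
          · simp [φ]
          · simp [φ, hψC]
            simp [hψ, linearPullback_shearProj_X]
      exact (RingHom.congr_fun this f).trans (Ideal.Quotient.eq_zero_iff_mem.2 hfI)
    refine ⟨Polynomial.C (C c⁻¹) * φ f, ?_, ?_⟩
    · refine Polynomial.monic_of_natDegree_le_of_coeff_eq_one d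
        ((Polynomial.natDegree_C_mul_le _ _).trans h1) ?_
      rw [Polynomial.coeff_C_mul, h2, ← C_mul, inv_mul_cancel₀ hf, C_1]
    · rw [Polynomial.eval₂_mul, h3, mul_zero]
  intro q
  obtain ⟨p, rfl⟩ := Ideal.Quotient.mk_surjective q
  induction p using MvPolynomial.induction_on with
  | C a => rw [← hψC]; exact ψ.isIntegralElem_map
  | add p q hp hq => rw [map_add]; exact hp.add ψ hq
  | mul_X p i hp =>
    rw [map_mul]
    refine hp.mul ψ ?_
    refine Fin.cases h0 (fun j => ?_) i
    have : Ideal.Quotient.mk I (X j.succ) = ψ (X j) + ψ (C (u j)) * Ideal.Quotient.mk I (X 0) := by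
      rw [hψC, ← map_mul]
      simp [hψ, linearPullback_shearProj_X]
    rw [this]
    exact ψ.isIntegralElem_map.add ψ (ψ.isIntegralElem_map.mul ψ h0)

/-- If some `f ∈ I` has top-degree form not vanishing at `(1, u)`, the zero locus of `I` projects
onto that of its elimination ideal along `(1, u)`. -/
theorem exists_zero_of_comap_shearProj (u : Fin n → ℂ)
    {I : Ideal (MvPolynomial (Fin (n + 1)) ℂ)} {f : MvPolynomial (Fin (n + 1)) ℂ} (hfI : f ∈ I)
    {d : ℕ} (hd : f.totalDegree ≤ d) (hf : eval (Fin.cons 1 u) (homogeneousComponent d f) ≠ 0)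
    {z : Fin n → ℂ} (hz : ∀ g ∈ I.comap (linearPullback (shearProj u)), eval z g = 0) :
    ∃ x, (∀ g ∈ I, eval x g = 0) ∧ shearProj u x = z := by
  set ψ := (Ideal.Quotient.mk I).comp (linearPullback (shearProj u)).toRingHom with hψ
  algebraize [ψ]
  have : Algebra.IsIntegral (MvPolynomial (Fin n) ℂ) (MvPolynomial (Fin (n + 1)) ℂ ⧸ I) :=
    ⟨isIntegral_comp_linearPullback_shearProj u hfI hd hf⟩
  have hmax : (vanishingIdeal ℂ {z}).IsMaximal :=
    isMaximal_iff_eq_vanishingIdeal_singleton.2 ⟨z, rfl⟩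
  obtain ⟨Q, hQ, hQz⟩ := Ideal.exists_ideal_over_maximal_of_isIntegral (vanishingIdeal ℂ {z})
    (S := MvPolynomial (Fin (n + 1)) ℂ ⧸ I) (fun g hg => by
      rw [mem_vanishingIdeal_singleton_iff]
      exact hz g (Ideal.mem_comap.2
        (Ideal.Quotient.eq_zero_iff_mem.1 (show Ideal.Quotient.mk I _ = 0 from hg))))
  have hQ' := Ideal.comap_isMaximal_of_surjective (Ideal.Quotient.mk I)
    Ideal.Quotient.mk_surjective (K := Q)
  obtain ⟨x, hx⟩ := isMaximal_iff_eq_vanishingIdeal_singleton.1 hQ'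
  have hxQ (p : MvPolynomial (Fin (n + 1)) ℂ) : eval x p = 0 ↔ Ideal.Quotient.mk I p ∈ Q := by
    rw [← Ideal.mem_comap, hx, mem_vanishingIdeal_singleton_iff]
    rfl
  refine ⟨x, fun g hg => ?_, ?_⟩
  · rw [hxQ, Ideal.Quotient.eq_zero_iff_mem.2 hg]
    exact Q.zero_mem
  · ext j
    have hj : X j - C (z j) ∈ Ideal.comap ψ Q := by
      have : (X j - C (z j) : MvPolynomial (Fin n) ℂ) ∈ vanishingIdeal ℂ {z} := by
        rw [mem_vanishingIdeal_singleton_iff]; simp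
      exact hQz ▸ this
    have h := (hxQ (linearPullback (shearProj u) (X j - C (z j)))).2 hj
    rw [eval_linearPullback] at h
    simpa [sub_eq_zero] using h

theorem mem_limitDirections_of_tail {I : Ideal (MvPolynomial (Fin (n + 1)) ℂ)} {u : Fin n → ℂ}
    {f : MvPolynomial (Fin (n + 1)) ℂ} (hfI : f ∈ I)
    {d : ℕ} (hd : f.totalDegree ≤ d) (hf : eval (Fin.cons 1 u) (homogeneousComponent d f) ≠ 0)
    {v : Fin (n + 1) → ℂ}
    (hinj : ∀ w ∈ initialCone I, shearProj u w = shearProj u v → w = v)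
    (hlim : shearProj u v ∈ limitDirections (I.comap (linearPullback (shearProj u)))) :
    v ∈ limitDirections I := by
  obtain ⟨z, t, hz, htpos, ht, hlim⟩ := hlim
  choose x hxI hxz using fun i => exists_zero_of_comap_shearProj u hfI hd hf (hz i)
  have ht0 (i : ℕ) : (t i : ℂ) ≠ 0 := Complex.ofReal_ne_zero.2 (htpos i).ne'
  have htn : Tendsto (fun i => ‖(t i : ℂ)‖) atTop atTop := by
    simpa [Function.comp_def] using tendsto_abs_atTop_atTop.comp ht
  have hdecomp (y : Fin (n + 1) → ℂ) :
      y = y 0 • (Fin.cons 1 u : Fin (n + 1) → ℂ) + Fin.cons 0 (shearProj u y) := by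
    ext i
    refine Fin.cases ?_ (fun j => ?_) i
    · simp
    · simp [shearProj_apply, Fin.tail]
  have hcons : Continuous fun y : Fin n → ℂ => (Fin.cons 0 y : Fin (n + 1) → ℂ) :=
    continuous_const.finCons continuous_id
  let a (i : ℕ) : ℂ := ((t i : ℂ)⁻¹ • x i) 0
  have hproj (i : ℕ) : shearProj u ((t i : ℂ)⁻¹ • x i) = (t i : ℂ)⁻¹ • z i := by
    rw [map_smul, hxz]
  by_cases ha : Tendsto (fun i => ‖a i‖) atTop atTop
  · exfalso
    have hmem : (Fin.cons 1 u : Fin (n + 1) → ℂ) ∈ initialCone I := by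
      refine mem_initialCone_of_tendsto (a := fun i => a i * t i) hxI ?_ ?_
      · simp only [norm_mul]
        exact ha.atTop_mul_atTop₀ htn
      · have hinv : Tendsto (fun i => (a i)⁻¹) atTop (𝓝 0) :=
          tendsto_inv₀_cobounded.comp (tendsto_norm_atTop_iff_cobounded.1 ha)
        have := (hinv.smul ((hcons.tendsto _).comp hlim)).const_add (Fin.cons 1 u)
        rw [zero_smul, add_zero] at this
        refine this.congr' ?_
        filter_upwards [ha.eventually_gt_atTop 0] with i hi
        have hi : a i ≠ 0 := norm_pos_iff.1 hi
        rw [mul_inv, mul_smul, hdecomp ((t i : ℂ)⁻¹ • x i), hproj, smul_add, smul_smul]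
        rw [inv_mul_cancel₀ hi, one_smul]
        rfl
    exact hf (hmem f hfI d hd)
  · obtain ⟨R, hR⟩ : ∃ R, ∃ᶠ i in atTop, a i ∈ Metric.ball 0 R := by
      rw [tendsto_atTop] at ha
      push Not at ha
      obtain ⟨R, hR⟩ := ha
      exact ⟨R, by simpa using hR⟩
    obtain ⟨b, -, φ, hφ, hb⟩ := tendsto_subseq_of_frequently_bounded Metric.isBounded_ball hR
    have hlim' : Tendsto (fun i => (t (φ i) : ℂ)⁻¹ • x (φ i)) atTop
        (𝓝 (b • (Fin.cons 1 u : Fin (n + 1) → ℂ) + Fin.cons 0 (shearProj u v))) := by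
      refine ((hb.smul_const _).add ((hcons.tendsto _).comp (hlim.comp hφ.tendsto_atTop))).congr
        fun i => ?_
      rw [hdecomp ((t (φ i) : ℂ)⁻¹ • x (φ i)), hproj]
      rfl
    have hw := hinj _ (mem_initialCone_of_tendsto (fun i => hxI (φ i))
      (htn.comp hφ.tendsto_atTop) hlim') (by
        ext j
        simp [shearProj_apply, Fin.tail])
    exact ⟨fun i => x (φ i), fun i => t (φ i), fun i => hxI _, fun i => htpos _,
      ht.comp hφ.tendsto_atTop, hw ▸ hlim'⟩

theorem initialCone_subset_limitDirections {I : Ideal (MvPolynomial (Fin n) ℂ)} {v : Fin n → ℂ}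
    (hv0 : v ≠ 0) (hv : v ∈ initialCone I) : v ∈ limitDirections I := by
  induction n with
  | zero => exact absurd (Subsingleton.elim v 0) hv0
  | succ n ih =>
  refine mem_limitDirections_of_forall_isPrime (fun P hP hvP => ?_) I hv
  clear hv I
  obtain ⟨A, hA⟩ := SeparatingDual.exists_continuousLinearEquiv_apply_eq (R := ℂ) hv0
    (y := Pi.single 0 1) (by simp)
  refine mem_limitDirections_of_equiv A ?_
  have hv := map_mem_initialCone (A : (Fin (n + 1) → ℂ) →ₗ[ℂ] (Fin (n + 1) → ℂ)) hvP
  rw [show (A : (Fin (n + 1) → ℂ) →ₗ[ℂ] (Fin (n + 1) → ℂ)) v = A v from rfl, hA] at hv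
  rw [hA]
  have hI := Ideal.comap_isPrime (linearPullback (A : (Fin (n + 1) → ℂ) →ₗ[ℂ] (Fin (n + 1) → ℂ))) P
  generalize P.comap (linearPullback (A : (Fin (n + 1) → ℂ) →ₗ[ℂ] (Fin (n + 1) → ℂ))) = I
    at hv hI
  by_cases hbot : I.comap (linearPullback (tailProj n)) = ⊥
  · obtain ⟨F, rfl⟩ := exists_eq_span_singleton_of_comap_eq_bot hbot
    exact mem_limitDirections_span_singleton hv
  obtain ⟨h, hI, h0⟩ := Submodule.exists_mem_ne_zero_of_ne_bot hbot
  obtain ⟨u, hu⟩ := exists_eval_homogeneousComponent_ne_zero h0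
  have htail (w : Fin (n + 1) → ℂ) (hw : w ∈ initialCone I) (s : ℂ) (hs : Fin.tail w = s • u) :
      s = 0 := by
    have := map_mem_initialCone (tailProj n) hw h hI _ le_rfl
    rw [show tailProj n w = Fin.tail w from rfl, hs,
      eval_smul_of_isHomogeneous (homogeneousComponent_isHomogeneous _ _)] at this
    exact eq_zero_of_pow_eq_zero ((mul_eq_zero.1 this).resolve_right hu)
  have hvt : Fin.tail (Pi.single 0 1 : Fin (n + 1) → ℂ) = 0 := by
    ext j; simp [Fin.tail]
  have hv' : shearProj u (Pi.single 0 1) = -u := by simp [shearProj_apply, hvt]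
  refine mem_limitDirections_of_tail (u := u) hI (totalDegree_linearPullback_le _ _) ?_ ?_
    (ih ?_ (map_mem_initialCone _ hv))
  · rw [homogeneousComponent_linearPullback, eval_linearPullback]
    exact hu
  · intro w hw hwv
    rw [hv', shearProj_apply] at hwv
    have hs : Fin.tail w = (w 0 - 1) • u := by
      rw [sub_smul, one_smul, sub_eq_add_neg, ← hwv]; abel
    have h1 := htail w hw _ hs
    rw [h1, zero_smul] at hs
    rw [← Fin.cons_self_tail w, hs, sub_eq_zero.1 h1]
    ext i
    refine Fin.cases ?_ (fun j => ?_) i <;> simp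
  · rw [hv', neg_ne_zero]
    rintro rfl
    exact one_ne_zero (htail _ hv 1 (by rw [hvt, smul_zero]))

/-- If `X ⊆ ℂⁿ` is an unbounded complex algebraic set, then its tangent cone at infinity
is the common zero set of the leading homogeneous forms `f*` of the nonzero polynomials
`f` vanishing on `X`. -/
theorem tangentConeAtInfinity_eq_zero_set_of_leading_forms {n : ℕ}
    (X : Set (EuclideanSpace ℂ (Fin n)))
    (hX : ¬ Bornology.IsBounded X)
    (halg : ∃ S : Set (MvPolynomial (Fin n) ℂ),
      X = {x : EuclideanSpace ℂ (Fin n) | ∀ f ∈ S, eval (fun i => x i) f = 0}) :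
    tangentConeAtInfinity X =
      {v : EuclideanSpace ℂ (Fin n) | ∀ f : MvPolynomial (Fin n) ℂ, f ≠ 0 →
        (∀ x ∈ X, eval (fun i => x i) f = 0) →
          eval (fun i => v i) (homogeneousComponent f.totalDegree f) = 0} := by
  have hX0 : X.Nonempty := by
    rw [Set.nonempty_iff_ne_empty]
    rintro rfl
    exact hX Bornology.isBounded_empty
  ext v
  constructor
  · rintro ⟨x, t, hx, htpos, hxn, hlim⟩ f hf hfX
    by_cases hv : v = 0
    · have hd : f.totalDegree ≠ 0 := by
        intro hd
        obtain ⟨y, hy⟩ := hX0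
        rw [totalDegree_eq_zero_iff_eq_C.1 hd] at hf hfX
        have := hfX y hy
        rw [eval_C] at this
        exact hf (by rw [this, C_0])
      have := eval_smul_of_isHomogeneous (homogeneousComponent_isHomogeneous f.totalDegree f) 0
        (fun i => v i)
      rw [zero_pow hd, zero_mul] at this
      rw [← this]
      congr 2
      ext i
      simp [hv]
    · have ht : Tendsto t atTop atTop := by
        have h1 : Tendsto (fun i => ‖(t i)⁻¹ • x i‖⁻¹ * ‖x i‖) atTop atTop :=
          (hlim.norm.inv₀ (norm_ne_zero_iff.2 hv)).pos_mul_atTop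
            (inv_pos.2 (norm_pos_iff.2 hv)) hxn
        refine h1.congr' ?_
        filter_upwards [hxn.eventually_gt_atTop 0] with i hi
        rw [norm_smul, norm_inv, Real.norm_of_nonneg (htpos i).le]
        field_simp
      refine mem_initialCone_of_tendsto (I := Ideal.span {f}) (x := fun i => WithLp.ofLp (x i))
        (a := fun i => t i) ?_ ?_ ?_ f (Ideal.mem_span_singleton_self f) _ le_rfl
      · intro i g hg
        obtain ⟨q, rfl⟩ := Ideal.mem_span_singleton.1 hg
        rw [map_mul, hfX _ (hx i), zero_mul]
      · simpa [Function.comp_def] using tendsto_abs_atTop_atTop.comp ht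
      · refine (((PiLp.continuous_ofLp 2 _).tendsto v).comp hlim).congr fun i => ?_
        ext j
        simp
  · intro hv
    by_cases hv0 : v = 0
    · have hbig (i : ℕ) : ∃ x ∈ X, (i : ℝ) + 1 ≤ ‖x‖ := by
        by_contra! h
        exact hX (isBounded_iff_forall_norm_le.2 ⟨_, fun x hx => (h x hx).le⟩)
      choose x hx hxn using hbig
      have hpos (i : ℕ) : 0 < ‖x i‖ := lt_of_lt_of_le (by positivity) (hxn i)
      have htop : Tendsto (fun i => ‖x i‖) atTop atTop :=
        tendsto_atTop_mono hxn (tendsto_atTop_add_const_right _ _ tendsto_natCast_atTop_atTop)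
      refine ⟨x, fun i => ‖x i‖ ^ 2, hx, fun i => pow_pos (hpos i) 2, htop, ?_⟩
      rw [hv0, tendsto_zero_iff_norm_tendsto_zero]
      refine htop.inv_tendsto_atTop.congr fun i => ?_
      have := (hpos i).ne'
      rw [norm_smul, norm_inv, norm_pow, norm_norm, Pi.inv_apply]
      field_simp
    · obtain ⟨S, rfl⟩ := halg
      let I : Ideal (MvPolynomial (Fin n) ℂ) := vanishingIdeal ℂ (zeroLocus ℂ (Ideal.span S))
      have hvI : WithLp.ofLp v ∈ initialCone I := by
        intro f hf d hd
        rcases hd.lt_or_eq with hd | rfl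
        · rw [homogeneousComponent_eq_zero _ _ hd, map_zero]
        by_cases hf0 : f = 0
        · simp [hf0]
        refine hv f hf0 fun x hx => hf _ ?_
        rw [zeroLocus_span]
        exact hx
      obtain ⟨x, t, hxI, htpos, ht, hlim⟩ :=
        initialCone_subset_limitDirections (by simpa using hv0) hvI
      have hlim' : Tendsto (fun i => (t i)⁻¹ • WithLp.toLp 2 (x i)) atTop (𝓝 v) := by
        refine (((PiLp.continuous_toLp 2 _).tendsto _).comp hlim).congr fun i => ?_
        ext j
        simp
      refine ⟨fun i => WithLp.toLp 2 (x i), t, fun i f hf => ?_, htpos, ?_, hlim'⟩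
      · exact hxI i f (le_vanishingIdeal_zeroLocus _ (Ideal.subset_span hf))
      · refine (ht.atTop_mul_pos (norm_pos_iff.2 hv0) hlim'.norm).congr fun i => ?_
        rw [norm_smul, norm_inv, Real.norm_of_nonneg (htpos i).le,
          mul_inv_cancel_left₀ (htpos i).ne']
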